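/- arXiv:1208.3816 — 5 statements merged into one kernel-verified Lean document; each statement's English description precedes it below -/
import Mathlib

section
/- Let ρ = (f, g, h) be a reduction from a chain complex (Ĉ, d̂) to a chain complex (C, d) of R-modules. Then: (i) for every q the module Ĉ_q is the internal direct sum Ĉ_q = A_q ⊕ B_q ⊕ C'_q, where A_q = ker f_q ∩ ker h_q, B_q = ker f_q ∩ ker d̂_q and C'_q = im g_q; (ii) C' = im g and ker f = A ⊕ B are subcomplexes of Ĉ, and B is a subcomplex on which the induced differential is zero; (iii) f and g restrict to mutually inverse chain-complex isomorphisms between C' and C; (iv) for every q, d̂ restricts to an R-module isomorphism A_q → B_{q−1} whose inverse is the restriction of h. -/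
/-!
Common setup: chain complexes of `R`-modules indexed by `ℤ`.

We index differentials so that `C.d q : C.X (q+1) →ₗ[R] C.X q` is the differential
going out of degree `q+1`; since `q` ranges over all of `ℤ`, this gives the
differential at every degree.
-/

universe u

/-- A chain complex of `R`-modules: a `ℤ`-indexed family of `R`-modules together with
`R`-linear differentials `d : C_{q+1} → C_q` satisfying `d ∘ d = 0`. -/
structure ChainCpx (R : Type u) [CommRing R] : Type (u + 1) where
  X : ℤ → Type u
  acg : ∀ q, AddCommGroup (X q)
  mod : ∀ q, Module R (X q)
  d : ∀ q : ℤ, X (q + 1) →ₗ[R] X q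
  dd : ∀ (q : ℤ) (x : X (q + 1 + 1)), d q (d (q + 1) x) = 0

attribute [instance] ChainCpx.acg ChainCpx.mod

variable {R : Type u} [CommRing R]

/-- A reduction `ρ = (f, g, h)` from a chain complex `Cbig` to a chain complex `Csmall`:
`f`, `g` are chain maps, `h` is a degree `+1` homotopy operator on `Cbig`, satisfying
`f ∘ g = id`, `g ∘ f + d ∘ h + h ∘ d = id`, `f ∘ h = 0`, `h ∘ g = 0`, `h ∘ h = 0`. -/
structure Reduction (Cbig Csmall : ChainCpx R) where
  f : ∀ q : ℤ, Cbig.X q →ₗ[R] Csmall.X q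
  g : ∀ q : ℤ, Csmall.X q →ₗ[R] Cbig.X q
  h : ∀ q : ℤ, Cbig.X q →ₗ[R] Cbig.X (q + 1)
  f_chain : ∀ (q : ℤ) (x : Cbig.X (q + 1)), Csmall.d q (f (q + 1) x) = f q (Cbig.d q x)
  g_chain : ∀ (q : ℤ) (y : Csmall.X (q + 1)), Cbig.d q (g (q + 1) y) = g q (Csmall.d q y)
  fg : ∀ (q : ℤ) (y : Csmall.X q), f q (g q y) = y
  gf_dh_hd : ∀ (q : ℤ) (x : Cbig.X (q + 1)),
    g (q + 1) (f (q + 1) x) + Cbig.d (q + 1) (h (q + 1) x) + h q (Cbig.d q x) = x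
  fh : ∀ (q : ℤ) (x : Cbig.X q), f (q + 1) (h q x) = 0
  hg : ∀ (q : ℤ) (y : Csmall.X q), h q (g q y) = 0
  hh : ∀ (q : ℤ) (x : Cbig.X q), h (q + 1) (h q x) = 0


namespace Reduction

variable {Cbig Csmall : ChainCpx R} (ρ : Reduction Cbig Csmall)

theorem h_d_mem (q : ℤ) (x : Cbig.X (q + 1)) :
    ρ.h q (Cbig.d q x) ∈ LinearMap.ker (ρ.f (q + 1)) ⊓ LinearMap.ker (ρ.h (q + 1)) :=
  ⟨ρ.fh q _, ρ.hh q _⟩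

theorem d_h_mem (q : ℤ) (x : Cbig.X (q + 1)) :
    Cbig.d (q + 1) (ρ.h (q + 1) x) ∈ LinearMap.ker (ρ.f (q + 1)) ⊓ LinearMap.ker (Cbig.d q) := by
  refine ⟨?_, Cbig.dd q _⟩
  rw [SetLike.mem_coe, LinearMap.mem_ker, ← ρ.f_chain, ρ.fh, map_zero]

theorem h_d_eq_self {q : ℤ} {x : Cbig.X (q + 1)}
    (hx : x ∈ LinearMap.ker (ρ.f (q + 1)) ⊓ LinearMap.ker (ρ.h (q + 1))) :
    ρ.h q (Cbig.d q x) = x := by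
  obtain ⟨hf, hh⟩ := hx
  rw [SetLike.mem_coe, LinearMap.mem_ker] at hf hh
  simpa [hf, hh] using ρ.gf_dh_hd q x

theorem d_h_eq_self {q : ℤ} {x : Cbig.X (q + 1)}
    (hx : x ∈ LinearMap.ker (ρ.f (q + 1)) ⊓ LinearMap.ker (Cbig.d q)) :
    Cbig.d (q + 1) (ρ.h (q + 1) x) = x := by
  obtain ⟨hf, hd⟩ := hx
  rw [SetLike.mem_coe, LinearMap.mem_ker] at hf hd
  simpa [hf, hd] using ρ.gf_dh_hd q x

theorem components_eq {q : ℤ} {a b : Cbig.X (q + 1)} (y : Csmall.X (q + 1))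
    (ha : a ∈ LinearMap.ker (ρ.f (q + 1)) ⊓ LinearMap.ker (ρ.h (q + 1)))
    (hb : b ∈ LinearMap.ker (ρ.f (q + 1)) ⊓ LinearMap.ker (Cbig.d q)) :
    a = ρ.h q (Cbig.d q (a + b + ρ.g (q + 1) y)) ∧
      b = Cbig.d (q + 1) (ρ.h (q + 1) (a + b + ρ.g (q + 1) y)) ∧
      ρ.g (q + 1) y = ρ.g (q + 1) (ρ.f (q + 1) (a + b + ρ.g (q + 1) y)) := by
  have had := ρ.h_d_eq_self ha
  have hbd := ρ.d_h_eq_self hb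
  obtain ⟨haf, hah⟩ := ha
  obtain ⟨hbf, hbd'⟩ := hb
  rw [SetLike.mem_coe, LinearMap.mem_ker] at haf hah hbf hbd'
  refine ⟨?_, ?_, ?_⟩
  · simp [had, hbd', ρ.g_chain, ρ.hg]
  · simp [hah, hbd, ρ.hg]
  · simp [haf, hbf, ρ.fg]

end Reduction

/-- **Structure of a reduction.** Let `ρ = (f, g, h)` be a reduction from `(Ĉ, d̂)` to
`(C, d)`.  Writing, for each degree (here the degree `q+1` component, `q` ranging over
all of `ℤ`), `A = ker f ⊓ ker h`, `B = ker f ⊓ ker d̂` and `C' = range g`, we have: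

(i) every `Ĉ_{q+1}` is the internal direct sum `A ⊕ B ⊕ C'`;
(ii) `C' = range g` and `ker f` are subcomplexes of `Ĉ`, `ker f = A ⊔ B` with
     `A ⊓ B = ⊥`, and the differential vanishes on `B`;
(iii) `f` and `g` restrict to mutually inverse chain-complex isomorphisms between
     `C'` and `C`;
(iv) `d̂` restricts to an isomorphism `A_{q+2} → B_{q+1}` whose inverse is the
     restriction of `h`. -/
theorem statement0 (Cbig Csmall : ChainCpx R) (ρ : Reduction Cbig Csmall) :
    -- (i) internal direct sum decomposition in every degree
    (∀ (q : ℤ) (x : Cbig.X (q + 1)),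
      ∃! t : ↥(LinearMap.ker (ρ.f (q + 1)) ⊓ LinearMap.ker (ρ.h (q + 1))) ×
          ↥(LinearMap.ker (ρ.f (q + 1)) ⊓ LinearMap.ker (Cbig.d q)) ×
          ↥(LinearMap.range (ρ.g (q + 1))),
        x = (t.1 : Cbig.X (q + 1)) + (t.2.1 : Cbig.X (q + 1)) + (t.2.2 : Cbig.X (q + 1))) ∧
    -- (ii) `range g` is a subcomplex
    (∀ (q : ℤ) (x : Cbig.X (q + 1)), x ∈ LinearMap.range (ρ.g (q + 1)) →
      Cbig.d q x ∈ LinearMap.range (ρ.g q)) ∧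
    -- (ii) `ker f` is a subcomplex
    (∀ (q : ℤ) (x : Cbig.X (q + 1)), x ∈ LinearMap.ker (ρ.f (q + 1)) →
      Cbig.d q x ∈ LinearMap.ker (ρ.f q)) ∧
    -- (ii) `ker f = A ⊕ B`
    (∀ q : ℤ, LinearMap.ker (ρ.f (q + 1)) =
      (LinearMap.ker (ρ.f (q + 1)) ⊓ LinearMap.ker (ρ.h (q + 1))) ⊔
        (LinearMap.ker (ρ.f (q + 1)) ⊓ LinearMap.ker (Cbig.d q))) ∧
    (∀ q : ℤ, (LinearMap.ker (ρ.f (q + 1)) ⊓ LinearMap.ker (ρ.h (q + 1))) ⊓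
        (LinearMap.ker (ρ.f (q + 1)) ⊓ LinearMap.ker (Cbig.d q)) = ⊥) ∧
    -- (ii) `B` is a subcomplex with null induced differential
    (∀ (q : ℤ) (x : Cbig.X (q + 1)),
      x ∈ LinearMap.ker (ρ.f (q + 1)) ⊓ LinearMap.ker (Cbig.d q) → Cbig.d q x = 0) ∧
    -- (iii) `f` and `g` are mutually inverse between `C' = range g` and `C`
    (∀ (q : ℤ) (y : Csmall.X q), ρ.f q (ρ.g q y) = y) ∧
    (∀ (q : ℤ) (x : Cbig.X q), x ∈ LinearMap.range (ρ.g q) → ρ.g q (ρ.f q x) = x) ∧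
    -- (iv) `d̂` restricts to an isomorphism `A → B` (one degree lower), with inverse `h`
    (∀ (q : ℤ) (x : Cbig.X (q + 1 + 1)),
      x ∈ LinearMap.ker (ρ.f (q + 1 + 1)) ⊓ LinearMap.ker (ρ.h (q + 1 + 1)) →
        Cbig.d (q + 1) x ∈ LinearMap.ker (ρ.f (q + 1)) ⊓ LinearMap.ker (Cbig.d q) ∧
        ρ.h (q + 1) (Cbig.d (q + 1) x) = x) ∧
    (∀ (q : ℤ) (y : Cbig.X (q + 1)),
      y ∈ LinearMap.ker (ρ.f (q + 1)) ⊓ LinearMap.ker (Cbig.d q) →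
        ρ.h (q + 1) y ∈ LinearMap.ker (ρ.f (q + 1 + 1)) ⊓ LinearMap.ker (ρ.h (q + 1 + 1)) ∧
        Cbig.d (q + 1) (ρ.h (q + 1) y) = y) := by
  refine ⟨fun q x => ?_, ?_, fun q x hx => ?_, fun q => le_antisymm (fun x hx => ?_) ?_,
    fun q => ?_, fun q x hx => hx.2, ρ.fg, ?_, fun q x hx => ⟨⟨?_, Cbig.dd q x⟩, ρ.h_d_eq_self hx⟩,
    fun q y hy => ⟨⟨ρ.fh _ y, ρ.hh _ y⟩, ρ.d_h_eq_self hy⟩⟩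
  · refine ⟨⟨⟨_, ρ.h_d_mem q x⟩, ⟨_, ρ.d_h_mem q x⟩, ⟨_, ρ.f (q + 1) x, rfl⟩⟩, ?_, ?_⟩
    · exact (ρ.gf_dh_hd q x).symm.trans (by dsimp only; abel)
    · rintro ⟨⟨a, ha⟩, ⟨b, hb⟩, ⟨_, y, rfl⟩⟩ rfl
      obtain ⟨h₁, h₂, h₃⟩ := ρ.components_eq y ha hb
      exact Prod.ext (Subtype.ext h₁) (Prod.ext (Subtype.ext h₂) (Subtype.ext h₃))
  · rintro q _ ⟨y, rfl⟩
    exact ⟨Csmall.d q y, (ρ.g_chain q y).symm⟩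
  · rw [LinearMap.mem_ker] at hx ⊢
    rw [← ρ.f_chain, hx, map_zero]
  · have hsum := ρ.gf_dh_hd q x
    rw [LinearMap.mem_ker.mp hx, map_zero, zero_add] at hsum
    exact Submodule.mem_sup.mpr ⟨_, ρ.h_d_mem q x, _, ρ.d_h_mem q x, (add_comm _ _).trans hsum⟩
  · exact sup_le inf_le_left inf_le_left
  · refine (Submodule.eq_bot_iff _).mpr fun x ⟨ha, hb⟩ => ?_
    rw [← ρ.h_d_eq_self ha, LinearMap.mem_ker.mp hb.2, map_zero]
  · rintro q _ ⟨y, rfl⟩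
    rw [ρ.fg]
  · rw [SetLike.mem_coe, LinearMap.mem_ker, ← ρ.f_chain, LinearMap.mem_ker.mp hx.1, map_zero]
end

section
/- (Easy Perturbation Lemma) Let ρ = (f, g, h) be a reduction from (Ĉ, d̂) to (C, d) and let δ be a perturbation of the differential d of the small chain complex. Then δ̂ := g ∘ δ ∘ f is a perturbation of d̂, i.e. (d̂ + g∘δ∘f) ∘ (d̂ + g∘δ∘f) = 0, and the same triple (f, g, h) is a reduction from the perturbed chain complex (Ĉ, d̂ + g∘δ∘f) to the perturbed chain complex (C, d + δ). -/
/-!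
Common setup: chain complexes of `R`-modules indexed by `ℤ`.

We index differentials so that `C.d q : C.X (q+1) →ₗ[R] C.X q` is the differential
going out of degree `q+1`; since `q` ranges over all of `ℤ`, this gives the
differential at every degree.
-/

universe u

variable {R : Type u} [CommRing R]

/-- A perturbation of the differential of a chain complex: a degree `-1` family `δ` of
`R`-linear maps such that `(d + δ) ∘ (d + δ) = 0`. -/
def IsPerturbation (C : ChainCpx R) (δ : ∀ q : ℤ, C.X (q + 1) →ₗ[R] C.X q) : Prop :=
  ∀ (q : ℤ) (x : C.X (q + 1 + 1)), (C.d q + δ q) ((C.d (q + 1) + δ (q + 1)) x) = 0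

/-- The chain complex obtained by perturbing the differential of `C` by `δ`. -/
def perturb (C : ChainCpx R) (δ : ∀ q : ℤ, C.X (q + 1) →ₗ[R] C.X q)
    (hδ : IsPerturbation C δ) : ChainCpx R where
  X := C.X
  acg := C.acg
  mod := C.mod
  d q := C.d q + δ q
  dd := hδ

/-- **Easy Perturbation Lemma.** Let `ρ = (f, g, h)` be a reduction from `(Ĉ, d̂)` to
`(C, d)` and let `δ` be a perturbation of the differential `d` of the small chain complex.
Then `δ̂ := g ∘ δ ∘ f` is a perturbation of `d̂`, and the *same* triple `(f, g, h)` is a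
reduction from the perturbed chain complex `(Ĉ, d̂ + g∘δ∘f)` to the perturbed chain
complex `(C, d + δ)`. -/
theorem statement1 (Cbig Csmall : ChainCpx R) (ρ : Reduction Cbig Csmall)
    (δ : ∀ q : ℤ, Csmall.X (q + 1) →ₗ[R] Csmall.X q) (hδ : IsPerturbation Csmall δ) :
    ∃ hb : IsPerturbation Cbig (fun q => (ρ.g q).comp ((δ q).comp (ρ.f (q + 1)))),
      ∃ ρ' : Reduction (perturb Cbig (fun q => (ρ.g q).comp ((δ q).comp (ρ.f (q + 1)))) hb)
          (perturb Csmall δ hδ),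
        ρ'.f = ρ.f ∧ ρ'.g = ρ.g ∧ ρ'.h = ρ.h := by
  have hb : IsPerturbation Cbig (fun q => (ρ.g q).comp ((δ q).comp (ρ.f (q + 1)))) := by
    intro q x
    have h := congrArg (ρ.g q) (hδ q (ρ.f (q + 1 + 1) x))
    simp only [LinearMap.add_apply, map_add, Csmall.dd, map_zero, zero_add] at h
    simp only [LinearMap.add_apply, LinearMap.comp_apply, map_add, Cbig.dd, ρ.g_chain,
      ← ρ.f_chain, ρ.fg, zero_add]
    rw [← h]
  refine ⟨hb, ⟨ρ.f, ρ.g, ρ.h, ?_, ?_, ρ.fg, ?_, ρ.fh, ρ.hg, ρ.hh⟩, rfl, rfl, rfl⟩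
  · intro q (x : Cbig.X (q + 1))
    change Csmall.d q (ρ.f (q + 1) x) + δ q (ρ.f (q + 1) x) =
      ρ.f q (Cbig.d q x + ρ.g q (δ q (ρ.f (q + 1) x)))
    rw [map_add, ρ.fg, ρ.f_chain]
  · intro q (y : Csmall.X (q + 1))
    change Cbig.d q (ρ.g (q + 1) y) + ρ.g q (δ q (ρ.f (q + 1) (ρ.g (q + 1) y))) =
      ρ.g q (Csmall.d q y + δ q y)
    rw [map_add, ρ.fg, ρ.g_chain]
  · intro q (x : Cbig.X (q + 1))
    change ρ.g (q + 1) (ρ.f (q + 1) x) + (Cbig.d (q + 1) (ρ.h (q + 1) x) +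
      ρ.g (q + 1) (δ (q + 1) (ρ.f (q + 1 + 1) (ρ.h (q + 1) x)))) +
      ρ.h q (Cbig.d q x + ρ.g q (δ q (ρ.f (q + 1) x))) = x
    rw [map_add, ρ.fh, ρ.hg, map_zero, map_zero, add_zero, add_zero, ρ.gf_dh_hd]
end

section
/- (Basic Perturbation Lemma) Let ρ = (f, g, h) be a reduction from (Ĉ, d̂) to (C, d) and let δ̂ be a perturbation of d̂ satisfying the nilpotency hypothesis: for every q and every x ∈ Ĉ_q there exists ν ∈ ℕ with (h ∘ δ̂)^ν(x) = 0. Then the pointwise-finite sums φ = Σ_{i≥0} (−1)^i (h ∘ δ̂)^i and ψ = Σ_{i≥0} (−1)^i (δ̂ ∘ h)^i are well-defined degree 0 R-linear endomorphisms of Ĉ; the family δ := f ∘ δ̂ ∘ φ ∘ g (which also equals f ∘ ψ ∘ δ̂ ∘ g) is a perturbation of d; and the triple (f ∘ ψ, φ ∘ g, h ∘ ψ) is a reduction from the perturbed chain complex (Ĉ, d̂ + δ̂) to the perturbed chain complex (C, d + δ). Moreover φ ∘ h = h ∘ ψ. -/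
/-!
Common setup: chain complexes of `R`-modules indexed by `ℤ`.

We index differentials so that `C.d q : C.X (q+1) →ₗ[R] C.X q` is the differential
going out of degree `q+1`; since `q` ranges over all of `ℤ`, this gives the
differential at every degree.
-/

universe u

variable {R : Type u} [CommRing R]

/-- A family indexed by the degrees `q + 1` extends to all degrees. -/
theorem exists_family_of_succ {P : ℤ → Type*} (φ : ∀ q : ℤ, P (q + 1)) :
    ∃ Φ : ∀ q : ℤ, P q, ∀ q, Φ (q + 1) = φ q := by
  refine ⟨fun q => sub_add_cancel q 1 ▸ φ (q - 1), fun q => ?_⟩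
  have key : ∀ (p : ℤ) (hp : p + 1 = q + 1), (hp ▸ φ p : P (q + 1)) = φ q := by
    intro p hp
    obtain rfl : p = q := by omega
    rfl
  exact key _ _

theorem forall_int_of_succ {P : ℤ → Prop} (h : ∀ q : ℤ, P (q + 1)) (q : ℤ) : P q := by
  simpa using h (q - 1)

section LocallyNilpotent

variable {M : Type*} [AddCommGroup M] [Module R M]

theorem alternating_sum_pow_eq_of_le (N : M →ₗ[R] M) {x : M} {ν μ : ℕ} (hνμ : ν ≤ μ)
    (hx : (N ^ ν) x = 0) :
    ∑ i ∈ Finset.range μ, ((-1 : ℤ) ^ i) • (N ^ i) x =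
      ∑ i ∈ Finset.range ν, ((-1 : ℤ) ^ i) • (N ^ i) x := by
  symm
  apply Finset.sum_subset (Finset.range_mono hνμ)
  intro i _ hi
  rw [Finset.mem_range, not_lt] at hi
  rw [Module.End.pow_map_zero_of_le hi hx, smul_zero]

/-- The alternating geometric series of a locally nilpotent endomorphism `N` is a two-sided
inverse of `1 + N`. -/
theorem exists_alternating_geometric_series (N : M →ₗ[R] M)
    (hN : ∀ x, ∃ ν : ℕ, (N ^ ν) x = 0) :
    ∃ S : M →ₗ[R] M,
      (∀ (x : M) (ν : ℕ), (N ^ ν) x = 0 →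
        S x = ∑ i ∈ Finset.range ν, ((-1 : ℤ) ^ i) • (N ^ i) x) ∧
      (∀ x, S x + N (S x) = x) ∧ ∀ x, S (x + N x) = x := by
  choose n hn using hN
  let T : M → M := fun x => ∑ i ∈ Finset.range (n x), ((-1 : ℤ) ^ i) • (N ^ i) x
  have hT : ∀ (x : M) (ν : ℕ), (N ^ ν) x = 0 →
      T x = ∑ i ∈ Finset.range ν, ((-1 : ℤ) ^ i) • (N ^ i) x := by
    intro x ν hx
    rcases le_total (n x) ν with h | h
    · exact (alternating_sum_pow_eq_of_le N h (hn x)).symm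
    · exact alternating_sum_pow_eq_of_le N h hx
  let S : M →ₗ[R] M :=
    { toFun := T
      map_add' := by
        intro x y
        have hx := Module.End.pow_map_zero_of_le (le_max_left (n x) (n y)) (hn x)
        have hy := Module.End.pow_map_zero_of_le (le_max_right (n x) (n y)) (hn y)
        rw [hT x _ hx, hT y _ hy, hT (x + y) (max (n x) (n y)) (by rw [map_add, hx, hy, add_zero]),
          ← Finset.sum_add_distrib]
        simp only [map_add, smul_add]
      map_smul' := by
        intro r x
        rw [hT (r • x) (n x) (by rw [map_smul, hn, smul_zero]), hT x _ (hn x), RingHom.id_apply,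
          Finset.smul_sum]
        simp only [map_smul, smul_comm r] }
  have hST : ∀ x, S x + N (S x) = x := by
    intro x
    change T x + N (T x) = x
    rw [hT x (n x + 1) (Module.End.pow_map_zero_of_le (Nat.le_succ _) (hn x))]
    nth_rewrite 2 [Finset.sum_range_succ]
    rw [hn x, smul_zero, add_zero, Finset.sum_range_succ', map_sum, add_right_comm,
      ← Finset.sum_add_distrib, Finset.sum_eq_zero]
    · simp
    · intro i _
      rw [map_zsmul, pow_succ' N, Module.End.mul_apply, pow_succ (-1 : ℤ)]
      simp
  refine ⟨S, hT, hST, fun x => ?_⟩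
  have hcomm : S (N x) = N (S x) := by
    change T (N x) = N (T x)
    rw [hT (N x) (n x), hT x _ (hn x), map_sum]
    · refine Finset.sum_congr rfl fun i _ => ?_
      rw [map_zsmul, ← Module.End.mul_apply, ← Module.End.mul_apply, ← pow_succ, ← pow_succ']
    · rw [← Module.End.mul_apply, ← pow_succ, pow_succ', Module.End.mul_apply, hn, map_zero]
  rw [map_add, hcomm, hST]

end LocallyNilpotent

theorem comp_pow_succ_apply {M M' : Type*} [AddCommGroup M] [Module R M] [AddCommGroup M']
    [Module R M'] (a : M →ₗ[R] M') (b : M' →ₗ[R] M) (ν : ℕ) (x : M) :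
    ((b.comp a) ^ (ν + 1)) x = b (((a.comp b) ^ ν) (a x)) := by
  induction ν with
  | zero => simp
  | succ ν ih => rw [pow_succ', Module.End.mul_apply, ih, pow_succ' (a.comp b)]; rfl

namespace Reduction

variable {Cbig Csmall : ChainCpx R} (ρ : Reduction Cbig Csmall)

/-- Two-sided inverses `φ` of `1 + h ∘ δ` and `ψ` of `1 + δ ∘ h`, in every degree. -/
structure PerturbationInverses (δ : ∀ q : ℤ, Cbig.X (q + 1) →ₗ[R] Cbig.X q) where
  φ : ∀ q : ℤ, Cbig.X q →ₗ[R] Cbig.X q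
  ψ : ∀ q : ℤ, Cbig.X q →ₗ[R] Cbig.X q
  φ_add : ∀ (q : ℤ) (x : Cbig.X (q + 1)), φ (q + 1) x + ρ.h q (δ q (φ (q + 1) x)) = x
  φ_apply : ∀ (q : ℤ) (x : Cbig.X (q + 1)), φ (q + 1) (x + ρ.h q (δ q x)) = x
  ψ_add : ∀ (q : ℤ) (x : Cbig.X q), ψ q x + δ q (ρ.h q (ψ q x)) = x
  ψ_apply : ∀ (q : ℤ) (x : Cbig.X q), ψ q (x + δ q (ρ.h q x)) = x

namespace PerturbationInverses

variable {ρ} {δ : ∀ q : ℤ, Cbig.X (q + 1) →ₗ[R] Cbig.X q} (I : PerturbationInverses ρ δ)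

theorem φ_h (q : ℤ) (x : Cbig.X q) : I.φ (q + 1) (ρ.h q x) = ρ.h q (I.ψ q x) := by
  rw [← I.φ_apply q (ρ.h q (I.ψ q x)), ← map_add, I.ψ_add]

theorem δ_φ (q : ℤ) (x : Cbig.X (q + 1)) : δ q (I.φ (q + 1) x) = I.ψ q (δ q x) := by
  rw [← I.ψ_apply q (δ q (I.φ (q + 1) x)), ← map_add, I.φ_add]

theorem f_φ (q : ℤ) (x : Cbig.X q) : ρ.f q (I.φ q x) = ρ.f q x := by
  revert x
  refine forall_int_of_succ (P := fun q => ∀ x, ρ.f q (I.φ q x) = ρ.f q x) (fun q x => ?_) q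
  conv_rhs => rw [← I.φ_add q x, map_add, ρ.fh, add_zero]

theorem h_φ (q : ℤ) (x : Cbig.X q) : ρ.h q (I.φ q x) = ρ.h q x := by
  revert x
  refine forall_int_of_succ (P := fun q => ∀ x, ρ.h q (I.φ q x) = ρ.h q x) (fun q x => ?_) q
  conv_rhs => rw [← I.φ_add q x, map_add, ρ.hh, add_zero]

theorem ψ_eq_self (q : ℤ) {x : Cbig.X q} (hx : ρ.h q x = 0) : I.ψ q x = x := by
  simpa [hx] using I.ψ_apply q x

theorem ψ_h (q : ℤ) (x : Cbig.X q) : I.ψ (q + 1) (ρ.h q x) = ρ.h q x :=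
  I.ψ_eq_self _ (ρ.hh q x)

theorem h_φ_g (q : ℤ) (y : Csmall.X q) : ρ.h q (I.φ q (ρ.g q y)) = 0 := by
  rw [I.h_φ, ρ.hg]

theorem ψ_φ_g (q : ℤ) (y : Csmall.X q) : I.ψ q (I.φ q (ρ.g q y)) = I.φ q (ρ.g q y) :=
  I.ψ_eq_self q (I.h_φ_g q y)

theorem f_ψ_φ_g (q : ℤ) (y : Csmall.X q) : ρ.f q (I.ψ q (I.φ q (ρ.g q y))) = y := by
  rw [I.ψ_φ_g, I.f_φ, ρ.fg]

/-- The perturbation of the small complex induced by `δ`. -/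
def inducedPerturbation (q : ℤ) : Csmall.X (q + 1) →ₗ[R] Csmall.X q :=
  (ρ.f q).comp ((δ q).comp ((I.φ (q + 1)).comp (ρ.g (q + 1))))

theorem inducedPerturbation_apply (q : ℤ) (y : Csmall.X (q + 1)) :
    I.inducedPerturbation q y = ρ.f q (I.ψ q (δ q (ρ.g (q + 1) y))) := by
  rw [← I.δ_φ]; rfl

theorem homotopy (hδ : IsPerturbation Cbig δ) (q : ℤ) (x : Cbig.X (q + 1)) :
    I.φ (q + 1) (ρ.g (q + 1) (ρ.f (q + 1) (I.ψ (q + 1) x))) +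
      (Cbig.d (q + 1) + δ (q + 1)) (ρ.h (q + 1) (I.ψ (q + 1) x)) +
      ρ.h q (I.ψ q ((Cbig.d q + δ q) x)) = x := by
  obtain ⟨y, hy⟩ : ∃ y, I.ψ (q + 1) x = y := ⟨_, rfl⟩
  have hx : x = y + δ (q + 1) (ρ.h (q + 1) y) := by rw [← hy, I.ψ_add]
  rw [hy, ← I.φ_h]
  refine Function.LeftInverse.injective (I.φ_apply q) ?_
  have h₁ := I.φ_add q (ρ.g (q + 1) (ρ.f (q + 1) y))
  have h₂ := I.φ_add q (ρ.h q ((Cbig.d q + δ q) x))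
  have h₃ := ρ.gf_dh_hd q y
  have h₄ := congrArg (ρ.h q) (hδ q (ρ.h (q + 1) y))
  have h₅ := congrArg (ρ.h q) (Cbig.dd q (ρ.h (q + 1) y))
  simp only [map_add, LinearMap.add_apply, map_zero, hx] at h₁ h₂ h₄ h₅ ⊢
  rw [h₅] at h₄
  linear_combination (norm := module) h₁ + h₂ + h₃ + h₄

theorem f_ψ_d_φ_g (q : ℤ) (y : Csmall.X (q + 1)) :
    ρ.f q (I.ψ q ((Cbig.d q + δ q) (I.φ (q + 1) (ρ.g (q + 1) y)))) =
      (Csmall.d q + I.inducedPerturbation q) y := by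
  obtain ⟨z, hz⟩ : ∃ z, I.φ (q + 1) (ρ.g (q + 1) y) = z := ⟨_, rfl⟩
  have hfz : ρ.f (q + 1) z = y := by rw [← hz, I.f_φ, ρ.fg]
  have h₁ := ρ.gf_dh_hd q z
  have hhz : ρ.h (q + 1) z = 0 := by rw [← hz, I.h_φ_g]
  rw [hfz, hhz, map_zero, add_zero] at h₁
  have h₂ := congrArg (ρ.f q) (I.ψ_apply q (Cbig.d q z))
  rw [← ρ.f_chain, hfz] at h₂
  have h₃ := congrArg (fun w => ρ.f q (I.ψ q (δ q w))) h₁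
  simp only [map_add] at h₂ h₃
  rw [hz, LinearMap.add_apply, LinearMap.add_apply, I.inducedPerturbation_apply]
  simp only [map_add]
  rw [← h₂, ← h₃]
  abel

theorem d_φ_g_f_ψ (hδ : IsPerturbation Cbig δ) (q : ℤ) (x : Cbig.X (q + 1)) :
    (Cbig.d q + δ q) (I.φ (q + 1) (ρ.g (q + 1) (ρ.f (q + 1) (I.ψ (q + 1) x)))) =
      I.φ q (ρ.g q (ρ.f q (I.ψ q ((Cbig.d q + δ q) x)))) := by
  revert x
  refine forall_int_of_succ (P := fun q => ∀ x,
    (Cbig.d q + δ q) (I.φ (q + 1) (ρ.g (q + 1) (ρ.f (q + 1) (I.ψ (q + 1) x)))) =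
      I.φ q (ρ.g q (ρ.f q (I.ψ q ((Cbig.d q + δ q) x))))) (fun q x => ?_) q
  have h₁ := I.homotopy hδ q ((Cbig.d (q + 1) + δ (q + 1)) x)
  have h₂ := congrArg (Cbig.d (q + 1) + δ (q + 1)) (I.homotopy hδ (q + 1) x)
  rw [hδ, map_zero, map_zero, add_zero] at h₁
  rw [map_add, map_add, hδ, add_zero] at h₂
  exact add_right_cancel (h₂.trans h₁.symm)

theorem perturbed_g_chain (hδ : IsPerturbation Cbig δ) (q : ℤ) (y : Csmall.X (q + 1)) :
    (Cbig.d q + δ q) (I.φ (q + 1) (ρ.g (q + 1) y)) =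
      I.φ q (ρ.g q ((Csmall.d q + I.inducedPerturbation q) y)) := by
  rw [← I.f_ψ_d_φ_g, ← I.d_φ_g_f_ψ hδ, I.f_ψ_φ_g]

theorem isPerturbation_inducedPerturbation (hδ : IsPerturbation Cbig δ) :
    IsPerturbation Csmall I.inducedPerturbation := by
  intro q y
  rw [← I.f_ψ_d_φ_g, ← I.perturbed_g_chain hδ, hδ, map_zero, map_zero]

theorem perturbed_f_chain (hδ : IsPerturbation Cbig δ) (q : ℤ) (x : Cbig.X (q + 1)) :
    (Csmall.d q + I.inducedPerturbation q) (ρ.f (q + 1) (I.ψ (q + 1) x)) =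
      ρ.f q (I.ψ q ((Cbig.d q + δ q) x)) := by
  rw [← I.f_ψ_d_φ_g, I.d_φ_g_f_ψ hδ, I.f_ψ_φ_g]

/-- The reduction between the perturbed complexes. -/
def perturbedReduction (hδ : IsPerturbation Cbig δ) :
    Reduction (perturb Cbig δ hδ)
      (perturb Csmall I.inducedPerturbation (I.isPerturbation_inducedPerturbation hδ)) where
  f q := (ρ.f q).comp (I.ψ q)
  g q := (I.φ q).comp (ρ.g q)
  h q := (ρ.h q).comp (I.ψ q)
  f_chain := I.perturbed_f_chain hδ
  g_chain := I.perturbed_g_chain hδ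
  fg := I.f_ψ_φ_g
  gf_dh_hd := I.homotopy hδ
  fh q x := by
    change ρ.f (q + 1) (I.ψ (q + 1) (ρ.h q (I.ψ q x))) = 0
    rw [I.ψ_h, ρ.fh]
  hg q y := (congrArg (ρ.h q) (I.ψ_φ_g q y)).trans (I.h_φ_g q y)
  hh q x := by
    change ρ.h (q + 1) (I.ψ (q + 1) (ρ.h q (I.ψ q x))) = 0
    rw [I.ψ_h, ρ.hh]

end PerturbationInverses

end Reduction

/-- **Basic Perturbation Lemma.** Let `ρ = (f, g, h)` be a reduction from `(Ĉ, d̂)` to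
`(C, d)` and let `δ̂` (here `δb`) be a perturbation of `d̂` satisfying the nilpotency
hypothesis: for every `x` there is `ν` with `(h ∘ δ̂)^ν x = 0`.  Then the pointwise-finite
series `φ = Σ (-1)^i (h∘δ̂)^i` and `ψ = Σ (-1)^i (δ̂∘h)^i` are well-defined degree `0`
`R`-linear endomorphisms (characterized by their values on the partial sums), `φ∘h = h∘ψ`,
the family `δ := f∘δ̂∘φ∘g = f∘ψ∘δ̂∘g` is a perturbation of `d`, and
`(f∘ψ, φ∘g, h∘ψ)` is a reduction from `(Ĉ, d̂ + δ̂)` to `(C, d + δ)`. -/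
theorem statement2 (Cbig Csmall : ChainCpx R) (ρ : Reduction Cbig Csmall)
    (δb : ∀ q : ℤ, Cbig.X (q + 1) →ₗ[R] Cbig.X q) (hδb : IsPerturbation Cbig δb)
    (hnil : ∀ (q : ℤ) (x : Cbig.X (q + 1)), ∃ ν : ℕ, (((ρ.h q).comp (δb q)) ^ ν) x = 0) :
    ∃ (φ : ∀ q : ℤ, Cbig.X (q + 1) →ₗ[R] Cbig.X (q + 1))
      (ψ : ∀ q : ℤ, Cbig.X q →ₗ[R] Cbig.X q),
      -- `φ` is the pointwise-finite sum `Σ_{i ≥ 0} (-1)^i (h ∘ δ̂)^i`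
      (∀ (q : ℤ) (x : Cbig.X (q + 1)) (ν : ℕ), (((ρ.h q).comp (δb q)) ^ ν) x = 0 →
        φ q x = ∑ i ∈ Finset.range ν, ((-1 : ℤ) ^ i) • ((((ρ.h q).comp (δb q)) ^ i) x)) ∧
      -- `ψ` is the pointwise-finite sum `Σ_{i ≥ 0} (-1)^i (δ̂ ∘ h)^i`
      (∀ (q : ℤ) (x : Cbig.X q) (ν : ℕ), (((δb q).comp (ρ.h q)) ^ ν) x = 0 →
        ψ q x = ∑ i ∈ Finset.range ν, ((-1 : ℤ) ^ i) • ((((δb q).comp (ρ.h q)) ^ i) x)) ∧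
      -- `φ ∘ h = h ∘ ψ`
      (∀ (q : ℤ) (x : Cbig.X q), φ q (ρ.h q x) = ρ.h q (ψ q x)) ∧
      -- the two formulas for the induced perturbation `δ` agree
      (∀ q : ℤ, (ρ.f q).comp ((δb q).comp ((φ q).comp (ρ.g (q + 1)))) =
        (ρ.f q).comp ((ψ q).comp ((δb q).comp (ρ.g (q + 1))))) ∧
      -- `δ := f ∘ δ̂ ∘ φ ∘ g` is a perturbation of `d`, and `(f∘ψ, φ∘g, h∘ψ)` is a
      -- reduction between the perturbed chain complexes
      ∃ hδ : IsPerturbation Csmall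
          (fun q => (ρ.f q).comp ((δb q).comp ((φ q).comp (ρ.g (q + 1))))),
        ∃ ρ' : Reduction (perturb Cbig δb hδb)
            (perturb Csmall (fun q => (ρ.f q).comp ((δb q).comp ((φ q).comp (ρ.g (q + 1))))) hδ),
          (∀ q : ℤ, ρ'.f q = (ρ.f q).comp (ψ q)) ∧
          (∀ q : ℤ, ρ'.g (q + 1) = (φ q).comp (ρ.g (q + 1))) ∧
          (∀ q : ℤ, ρ'.h q = (ρ.h q).comp (ψ q)) := by
  have hnil' : ∀ (q : ℤ) (x : Cbig.X q), ∃ ν : ℕ, (((δb q).comp (ρ.h q)) ^ ν) x = 0 := by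
    intro q x
    obtain ⟨ν, hν⟩ := hnil q (ρ.h q x)
    exact ⟨ν + 1, by rw [comp_pow_succ_apply, hν, map_zero]⟩
  choose φ hφ hφ_add hφ_apply using
    fun q => exists_alternating_geometric_series _ (hnil q)
  choose ψ hψ hψ_add hψ_apply using
    fun q => exists_alternating_geometric_series _ (hnil' q)
  obtain ⟨Φ, hΦ⟩ := exists_family_of_succ (P := fun q => Cbig.X q →ₗ[R] Cbig.X q) φ
  obtain rfl : (fun q => Φ (q + 1)) = φ := funext hΦ
  let I : Reduction.PerturbationInverses ρ δb := ⟨Φ, ψ, hφ_add, hφ_apply, hψ_add, hψ_apply⟩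
  refine ⟨fun q => Φ (q + 1), ψ, hφ, hψ, I.φ_h, fun q => ?_,
    I.isPerturbation_inducedPerturbation hδb, I.perturbedReduction hδb,
    fun _ => rfl, fun _ => rfl, fun _ => rfl⟩
  exact LinearMap.ext fun y => I.inducedPerturbation_apply q y
end

section
/- Given an effective short exact sequence of chain complexes (i : C → B, j : B → A, ρ : B → C, σ : A → B), the connection morphism χ := ρ ∘ d_B ∘ σ, whose components are R-linear maps χ_q : A_q → C_{q−1}, anticommutes with the differentials: d_C ∘ χ = − χ ∘ d_A. Equivalently, χ is a chain-complex morphism from A to the suspension C^{[1]} of C (same modules shifted up by one degree, with differential −d_C). -/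
/-!
Common setup: chain complexes of `R`-modules indexed by `ℤ`.

We index differentials so that `C.d q : C.X (q+1) →ₗ[R] C.X q` is the differential
going out of degree `q+1`; since `q` ranges over all of `ℤ`, this gives the
differential at every degree.
-/

universe u

variable {R : Type u} [CommRing R]

/-- `φ` is a morphism of chain complexes from `Csrc` to `Ctgt`. -/
def IsChainMap (Csrc Ctgt : ChainCpx R) (φ : ∀ q : ℤ, Csrc.X q →ₗ[R] Ctgt.X q) : Prop :=
  ∀ (q : ℤ) (y : Csrc.X (q + 1)), Ctgt.d q (φ (q + 1) y) = φ q (Csrc.d q y)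

/-- Given an effective short exact sequence of chain complexes
`(i : C → B, j : B → A, ρ : B → C, σ : A → B)`, the connection morphism
`χ := ρ ∘ d_B ∘ σ` (with components `χ_q : A_q → C_{q-1}`) anticommutes with the
differentials: `d_C ∘ χ = − χ ∘ d_A`; equivalently, `χ` is a chain-complex morphism
from `A` to the suspension of `C` (same modules shifted up by one degree, with
differential `−d_C`).  Here the identity is stated on the degree `q+2` component,
`q` ranging over all of `ℤ`. -/
theorem statement8 (A B C : ChainCpx R)
    (i : ∀ q : ℤ, C.X q →ₗ[R] B.X q) (j : ∀ q : ℤ, B.X q →ₗ[R] A.X q)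
    (retr : ∀ q : ℤ, B.X q →ₗ[R] C.X q) (sec : ∀ q : ℤ, A.X q →ₗ[R] B.X q)
    (hi : IsChainMap C B i) (hj : IsChainMap B A j)
    (h_ri : ∀ (q : ℤ) (x : C.X q), retr q (i q x) = x)
    (h_split : ∀ (q : ℤ) (b : B.X q), i q (retr q b) + sec q (j q b) = b)
    (h_js : ∀ (q : ℤ) (a : A.X q), j q (sec q a) = a) :
    ∀ (q : ℤ) (x : A.X (q + 1 + 1)),
      C.d q (retr (q + 1) (B.d (q + 1) (sec (q + 1 + 1) x))) =
        - retr q (B.d q (sec (q + 1) (A.d (q + 1) x))) := by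
  intro q x
  have hb := h_split (q + 1) (B.d (q + 1) (sec (q + 1 + 1) x))
  rw [← hj (q + 1), h_js] at hb
  have hd := congrArg (fun b => retr q (B.d q b)) hb
  simp only [map_add, B.dd, map_zero] at hd
  rw [hi, h_ri] at hd
  exact eq_neg_of_add_eq_zero_left hd
end

section
/- (Composition of equivalences) Let ε be an equivalence between chain complexes A and C, given by a pair of reductions B ⇒ A and B ⇒ C, and let ε' be an equivalence between C and E, given by a pair of reductions D ⇒ C and D ⇒ E (the middle complex C being the same in both). Then there exist a chain complex F and an equivalence between A and E, i.e. a pair of reductions F ⇒ A and F ⇒ E. -/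
/-!
Common setup: chain complexes of `R`-modules indexed by `ℤ`.

We index differentials so that `C.d q : C.X (q+1) →ₗ[R] C.X q` is the differential
going out of degree `q+1`; since `q` ranges over all of `ℤ`, this gives the
differential at every degree.
-/

universe u

variable {R : Type u} [CommRing R]

/-- Composition of reductions. -/
def Reduction.comp {A B C : ChainCpx R} (r : Reduction A B) (s : Reduction B C) :
    Reduction A C where
  f q := s.f q ∘ₗ r.f q
  g q := r.g q ∘ₗ s.g q
  h q := r.h q + r.g (q + 1) ∘ₗ s.h q ∘ₗ r.f q
  f_chain q x := by simp [s.f_chain, r.f_chain]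
  g_chain q y := by simp [s.g_chain, r.g_chain]
  fg q y := by simp [s.fg, r.fg]
  gf_dh_hd q x := by
    have hr := r.gf_dh_hd q x
    have hs := congrArg (r.g (q + 1)) (s.gf_dh_hd q (r.f (q + 1) x))
    simp only [map_add] at hs
    simp only [LinearMap.comp_apply, LinearMap.add_apply, map_add, r.g_chain, ← r.f_chain]
    rw [← hs] at hr
    refine Eq.trans ?_ hr
    abel
  fh q x := by simp [s.fh, r.fh, r.fg]
  hg q y := by simp [s.hg, r.hg, r.fg]
  hh q x := by simp [s.hh, r.hh, r.hg, r.fh, r.fg]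

/-- The pullback `B ×_C D` of the projections of two reductions onto `C`. -/
def Reduction.pullback {B C D : ChainCpx R} (r : Reduction B C) (s : Reduction D C) :
    ChainCpx R where
  X q := LinearMap.eqLocus (r.f q ∘ₗ LinearMap.fst R (B.X q) (D.X q))
    (s.f q ∘ₗ LinearMap.snd R (B.X q) (D.X q))
  acg _ := inferInstance
  mod _ := inferInstance
  d q := ((B.d q).prodMap (D.d q)).restrict fun x hx => by
    have hx' : r.f (q + 1) x.1 = s.f (q + 1) x.2 := hx
    change r.f q (B.d q x.1) = s.f q (D.d q x.2)
    rw [← r.f_chain, ← s.f_chain, hx']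
  dd q x := Subtype.ext (Prod.ext (B.dd q x.1.1) (D.dd q x.1.2))

/-- The first projection from the pullback is part of a reduction. -/
def Reduction.pullbackFst {B C D : ChainCpx R} (r : Reduction B C) (s : Reduction D C) :
    Reduction (r.pullback s) B where
  f q := LinearMap.fst R (B.X q) (D.X q) ∘ₗ Submodule.subtype _
  g q := (LinearMap.id.prod (s.g q ∘ₗ r.f q)).codRestrict _ fun x => (s.fg q (r.f q x)).symm
  h q := (LinearMap.prodMap 0 (s.h q)).restrict fun x _ =>
    (map_zero (r.f (q + 1))).trans (s.fh q x.2).symm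
  f_chain _ _ := rfl
  g_chain q y := Subtype.ext (Prod.ext rfl
    ((s.g_chain q _).trans (congrArg (s.g q) (r.f_chain q y))))
  fg _ _ := rfl
  gf_dh_hd q x := by
    have hx : r.f (q + 1) x.1.1 = s.f (q + 1) x.1.2 := x.2
    refine Subtype.ext (Prod.ext ?_ ?_)
    · change x.1.1 + B.d (q + 1) 0 + 0 = x.1.1
      simp
    · change s.g (q + 1) (r.f (q + 1) x.1.1) + D.d (q + 1) (s.h (q + 1) x.1.2)
        + s.h q (D.d q x.1.2) = x.1.2
      rw [hx, s.gf_dh_hd]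
  fh _ _ := rfl
  hg q y := Subtype.ext (Prod.ext rfl (s.hg q (r.f q y)))
  hh q x := Subtype.ext (Prod.ext rfl (s.hh q x.1.2))

/-- The second projection from the pullback is part of a reduction. -/
def Reduction.pullbackSnd {B C D : ChainCpx R} (r : Reduction B C) (s : Reduction D C) :
    Reduction (r.pullback s) D where
  f q := LinearMap.snd R (B.X q) (D.X q) ∘ₗ Submodule.subtype _
  g q := ((r.g q ∘ₗ s.f q).prod LinearMap.id).codRestrict _ fun x => r.fg q (s.f q x)
  h q := (LinearMap.prodMap (r.h q) 0).restrict fun x _ =>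
    (r.fh q x.1).trans (map_zero (s.f (q + 1))).symm
  f_chain _ _ := rfl
  g_chain q y := Subtype.ext (Prod.ext
    ((r.g_chain q _).trans (congrArg (r.g q) (s.f_chain q y))) rfl)
  fg _ _ := rfl
  gf_dh_hd q x := by
    have hx : r.f (q + 1) x.1.1 = s.f (q + 1) x.1.2 := x.2
    refine Subtype.ext (Prod.ext ?_ ?_)
    · change r.g (q + 1) (s.f (q + 1) x.1.2) + B.d (q + 1) (r.h (q + 1) x.1.1)
        + r.h q (B.d q x.1.1) = x.1.1
      rw [← hx, r.gf_dh_hd]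
    · change x.1.2 + D.d (q + 1) 0 + 0 = x.1.2
      simp
  fh _ _ := rfl
  hg q y := Subtype.ext (Prod.ext (r.hg q (s.f q y)) rfl)
  hh q x := Subtype.ext (Prod.ext (r.hh q x.1.1) rfl)

/-- **Composition of equivalences.** A (strong) equivalence between chain complexes `A` and
`C` is a pair of reductions from a common chain complex; given an equivalence between `A`
and `C` (reductions `B ⇒ A`, `B ⇒ C`) and an equivalence between `C` and `E` (reductions
`D ⇒ C`, `D ⇒ E`), there exist a chain complex `F` and an equivalence between `A` and `E`,
i.e. a pair of reductions `F ⇒ A` and `F ⇒ E`. -/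
theorem statement10 (A B C D E : ChainCpx R)
    (lred : Reduction B A) (rred : Reduction B C)
    (lred' : Reduction D C) (rred' : Reduction D E) :
    ∃ F : ChainCpx R, Nonempty (Reduction F A) ∧ Nonempty (Reduction F E) := by
  exact ⟨rred.pullback lred', ⟨(rred.pullbackFst lred').comp lred⟩,
    ⟨(rred.pullbackSnd lred').comp rred'⟩⟩
end
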